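/- Let k ≥ 2 and let f : 𝔽₂ⁿ → {−1,1} be a k-Fourier-sparse Boolean function with Fourier dimension Fdim(f) = r ≥ 1. Then there exist an invertible matrix B ∈ 𝔽₂^{n×n} and an index i ∈ [r] such that f̂_B(e_j) ≠ 0 for all j ∈ [r] and Fdim((f_B)^{(i)}) ≥ r − log₂ k. -/

import Mathlib

/-- The Fourier coefficient of `f : 𝔽₂ⁿ → ℝ` at `S ∈ 𝔽₂ⁿ`. -/
noncomputable def fCoeff {n : ℕ} (f : (Fin n → ZMod 2) → ℝ) (S : Fin n → ZMod 2) : ℝ :=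
  (1 / 2 ^ n) * ∑ x : Fin n → ZMod 2, f x * (-1 : ℝ) ^ (∑ i, (S i).val * (x i).val)

/-- The Fourier support of `f`. -/
noncomputable def fSupp {n : ℕ} (f : (Fin n → ZMod 2) → ℝ) : Set (Fin n → ZMod 2) :=
  {S | fCoeff f S ≠ 0}

/-- The `j`-th standard basis vector of `𝔽₂ⁿ`. -/
def stdBasis {n : ℕ} (j : Fin n) : Fin n → ZMod 2 :=
  fun i => if i = j then 1 else 0

/-- For invertible `B ∈ 𝔽₂^{n×n}`, the function `f_B(x) = f((B⁻¹)ᵀ x)`. -/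
noncomputable def changeBasis {n : ℕ} (f : (Fin n → ZMod 2) → ℝ)
    (B : Matrix (Fin n) (Fin n) (ZMod 2)) : (Fin n → ZMod 2) → ℝ :=
  fun x => f (B⁻¹.transpose.mulVec x)

/-- The restriction `g^{(i)}` of `g`, fixing `x_i = b` where `b ∈ {0,1}` is chosen so that
`(−1)^b·ĝ(e_i) = |ĝ(e_i)|` (and `b = 0` if `ĝ(e_i) = 0`). -/
noncomputable def restrictAt {n : ℕ} (g : (Fin n → ZMod 2) → ℝ) (i : Fin n) :
    (Fin n → ZMod 2) → ℝ :=
  fun x => g (Function.update x i (if fCoeff g (stdBasis i) < 0 then 1 else 0))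

/-- The sign `(−1)^a` of an element of `𝔽₂`. -/
def signChar (a : ZMod 2) : ℝ := if a = 0 then 1 else -1

theorem signChar_zero : signChar 0 = 1 := by simp [signChar]

theorem signChar_one : signChar 1 = -1 := by simp [signChar]

theorem eq_zero_or_one_zmod_two (a : ZMod 2) : a = 0 ∨ a = 1 := by
  revert a; decide

theorem signChar_add (a b : ZMod 2) : signChar (a + b) = signChar a * signChar b := by
  have h : (1 + 1 : ZMod 2) = 0 := by decide
  rcases eq_zero_or_one_zmod_two a with rfl | rfl <;>
    rcases eq_zero_or_one_zmod_two b with rfl | rfl <;>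
    simp [signChar_zero, signChar_one, h]

theorem signChar_mul_self (a : ZMod 2) : signChar a * signChar a = 1 := by
  rw [← signChar_add, CharTwo.add_self_eq_zero, signChar_zero]

theorem signChar_eq_or (a : ZMod 2) : signChar a = 1 ∨ signChar a = -1 := by
  unfold signChar; split_ifs <;> simp

theorem abs_signChar (a : ZMod 2) : |signChar a| = 1 := by
  rcases signChar_eq_or a with h | h <;> simp [h]

theorem neg_one_pow_eq_signChar {n : ℕ} (S x : Fin n → ZMod 2) :
    (-1 : ℝ) ^ (∑ i, (S i).val * (x i).val) = signChar (S ⬝ᵥ x) := by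
  have h : ((∑ i, (S i).val * (x i).val : ℕ) : ZMod 2) = S ⬝ᵥ x := by
    simp [dotProduct]
  rw [← h, signChar]
  split_ifs with h0
  · exact ((ZMod.natCast_eq_zero_iff_even).1 h0).neg_one_pow
  · exact (Nat.not_even_iff_odd.1 fun he => h0 (ZMod.natCast_eq_zero_iff_even.2 he)).neg_one_pow

theorem fCoeff_eq {n : ℕ} (f : (Fin n → ZMod 2) → ℝ) (S : Fin n → ZMod 2) :
    fCoeff f S = (1 / 2 ^ n) * ∑ x, f x * signChar (S ⬝ᵥ x) := by
  simp only [fCoeff, neg_one_pow_eq_signChar]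

theorem stdBasis_eq_single {n : ℕ} (j : Fin n) : stdBasis j = Pi.single j 1 := by
  ext i; simp [stdBasis, Pi.single_apply]

theorem stdBasis_dotProduct {n : ℕ} (j : Fin n) (x : Fin n → ZMod 2) :
    stdBasis j ⬝ᵥ x = x j := by
  simp [stdBasis_eq_single]

/-- Nontrivial characters of `𝔽₂ⁿ` sum to zero. -/
theorem sum_signChar_dotProduct {n : ℕ} {S : Fin n → ZMod 2} (hS : S ≠ 0) :
    ∑ x, signChar (S ⬝ᵥ x) = 0 := by
  obtain ⟨i, hi⟩ : ∃ i, S i ≠ 0 := by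
    by_contra! h; exact hS (funext h)
  have hi1 : S i = 1 := (eq_zero_or_one_zmod_two _).resolve_left hi
  have h := Equiv.sum_comp (Equiv.addRight (stdBasis i)) fun x => signChar (S ⬝ᵥ x)
  have h2 : ∀ x, signChar (S ⬝ᵥ (Equiv.addRight (stdBasis i)) x) = -signChar (S ⬝ᵥ x) := by
    intro x
    rw [Equiv.coe_addRight, dotProduct_add, dotProduct_comm S (stdBasis i),
      stdBasis_dotProduct, hi1, signChar_add, signChar_one]
    ring
  simp only [h2, Finset.sum_neg_distrib] at h
  linarith

theorem sum_signChar_dotProduct_left {n : ℕ} {x : Fin n → ZMod 2} (hx : x ≠ 0) :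
    ∑ S, signChar (S ⬝ᵥ x) = 0 := by
  simpa only [dotProduct_comm] using sum_signChar_dotProduct hx

/-- Fourier inversion at the origin. -/
theorem sum_fCoeff {n : ℕ} (f : (Fin n → ZMod 2) → ℝ) : ∑ S, fCoeff f S = f 0 := by
  simp only [fCoeff_eq, ← Finset.mul_sum]
  rw [Finset.sum_comm, Finset.sum_eq_single 0]
  · simp [signChar_zero]
  · intro x _ hx
    rw [← Finset.mul_sum, sum_signChar_dotProduct_left hx, mul_zero]
  · simp

/-- Averaging over the translation by `w` kills the frequencies not orthogonal to `w`. -/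
theorem fCoeff_average {n : ℕ} (h : (Fin n → ZMod 2) → ℝ) (w Q : Fin n → ZMod 2) :
    fCoeff (fun x => h x + h (x + w)) Q = (1 + signChar (Q ⬝ᵥ w)) * fCoeff h Q := by
  have e := Equiv.sum_comp (Equiv.addRight w) fun x => h x * signChar (Q ⬝ᵥ (x + w))
  have ww : w + w = 0 := funext fun i => CharTwo.add_self_eq_zero (w i)
  simp only [Equiv.coe_addRight, add_assoc, ww, add_zero] at e
  simp only [fCoeff_eq, add_mul, Finset.sum_add_distrib, e]
  simp only [dotProduct_add, signChar_add, ← mul_assoc, ← Finset.sum_mul]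
  ring

/-- Every nonempty finite set of nonzero vectors has fewer than half its members orthogonal to a
suitable vector. -/
theorem exists_two_mul_card_orthogonal_lt {n : ℕ} {N : Finset (Fin n → ZMod 2)}
    (hN : N.Nonempty) (h0 : 0 ∉ N) :
    ∃ w : Fin n → ZMod 2, 2 * (N.filter fun Q => Q ⬝ᵥ w = 0).card < N.card := by
  have hsum : ∑ w : Fin n → ZMod 2, ∑ Q ∈ N, signChar (Q ⬝ᵥ w) = 0 := by
    rw [Finset.sum_comm]
    exact Finset.sum_eq_zero fun Q hQ =>
      sum_signChar_dotProduct fun h => h0 (h ▸ hQ)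
  obtain ⟨w, hw⟩ : ∃ w : Fin n → ZMod 2, ∑ Q ∈ N, signChar (Q ⬝ᵥ w) < 0 := by
    by_contra! hc
    have := (Finset.sum_eq_zero_iff_of_nonneg fun w _ => hc w).1 hsum 0 (Finset.mem_univ _)
    simp [signChar_zero] at this
    exact hN.ne_empty this
  refine ⟨w, ?_⟩
  have e : ∑ Q ∈ N, signChar (Q ⬝ᵥ w)
      = 2 * ((N.filter fun Q => Q ⬝ᵥ w = 0).card : ℝ) - N.card := by
    have : ∀ Q : Fin n → ZMod 2, signChar (Q ⬝ᵥ w) = 2 * (if Q ⬝ᵥ w = 0 then 1 else 0) - 1 := by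
      intro Q; unfold signChar; split_ifs <;> norm_num
    simp only [this, Finset.sum_sub_distrib, ← Finset.mul_sum]
    simp
  rw [e] at hw
  have : (2 * ((N.filter fun Q => Q ⬝ᵥ w = 0).card : ℝ)) < N.card := by linarith
  exact_mod_cast this

/-- The mean of an integer-valued function with nonzero frequencies in `N` has denominator a power
of two at most `|N| + 1`. -/
theorem exists_fCoeff_zero_mul_two_pow {n : ℕ} (N : Finset (Fin n → ZMod 2)) (h0 : 0 ∉ N)
    (h : (Fin n → ZMod 2) → ℝ) (hint : ∀ x, ∃ z : ℤ, h x = z)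
    (hsupp : ∀ Q, Q ≠ 0 → Q ∉ N → fCoeff h Q = 0) :
    ∃ (t : ℕ) (z : ℤ), 2 ^ t ≤ N.card + 1 ∧ fCoeff h 0 * 2 ^ t = z := by
  induction hc : N.card using Nat.strong_induction_on generalizing N h with
  | _ c ih =>
  subst hc
  rcases N.eq_empty_or_nonempty with rfl | hne
  · obtain ⟨z, hz⟩ := hint 0
    refine ⟨0, z, by simp, ?_⟩
    rw [← hz, ← sum_fCoeff h, Finset.sum_eq_single 0]
    · simp
    · exact fun Q _ hQ => hsupp Q hQ (by simp)
    · simp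
  · obtain ⟨w, hw⟩ := exists_two_mul_card_orthogonal_lt hne h0
    obtain ⟨t, z, ht, hz⟩ := ih _ (by omega) (N.filter fun Q => Q ⬝ᵥ w = 0)
      (by simp [h0]) (fun x => h x + h (x + w))
      (fun x => by
        obtain ⟨a, ha⟩ := hint x
        obtain ⟨b, hb⟩ := hint (x + w)
        exact ⟨a + b, by simp [ha, hb]⟩)
      (fun Q hQ hQN => by
        rw [fCoeff_average]
        by_cases hm : Q ∈ N
        · have : Q ⬝ᵥ w ≠ 0 := fun h' => hQN (Finset.mem_filter.2 ⟨hm, h'⟩)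
          simp [signChar, this]
        · rw [hsupp Q hQ hm, mul_zero]) rfl
    refine ⟨t + 1, z, by rw [pow_succ]; omega, ?_⟩
    rw [← hz, fCoeff_average, zero_dotProduct, signChar_zero]
    ring

theorem fCoeff_mul_signChar {n : ℕ} (f : (Fin n → ZMod 2) → ℝ) (α Q : Fin n → ZMod 2) :
    fCoeff (fun x => f x * signChar (α ⬝ᵥ x)) Q = fCoeff f (Q + α) := by
  simp only [fCoeff_eq, add_dotProduct, signChar_add]
  congr 1
  exact Finset.sum_congr rfl fun x _ => by ring

/-- Granularity of the Fourier coefficients of a sparse Boolean function. -/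
theorem fCoeff_granularity {n k : ℕ} (hk : 2 ≤ k) (f : (Fin n → ZMod 2) → ℝ)
    (hf : ∀ x, f x = 1 ∨ f x = -1) (hsparse : (fSupp f).ncard ≤ k)
    {α : Fin n → ZMod 2} (hα : fCoeff f α ≠ 0) {m : ℕ} (hm : |fCoeff f α| * 2 ^ m ≤ 1) :
    2 ^ (m + 1) ≤ k := by
  classical
  let N : Finset (Fin n → ZMod 2) :=
    Finset.univ.filter fun Q => Q ≠ 0 ∧ fCoeff f (Q + α) ≠ 0
  have hN : N.card + 1 ≤ k := by
    refine le_trans ?_ hsparse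
    have h1 : (insert 0 N).card = N.card + 1 := Finset.card_insert_of_notMem (by simp [N])
    rw [← h1, ← Set.ncard_coe_finset]
    refine Set.ncard_le_ncard_of_injOn (fun Q => Q + α) ?_
      (fun a _ b _ hab => add_right_cancel hab) (Set.toFinite _)
    intro Q hQ
    simp only [Finset.coe_insert, Set.mem_insert_iff, Finset.mem_coe] at hQ
    rcases hQ with rfl | hQ
    · simpa [fSupp] using hα
    · exact (Finset.mem_filter.1 hQ).2.2
  have hone : ∀ Q : Fin n → ZMod 2, fCoeff (fun x => (f x * signChar (α ⬝ᵥ x) - 1) / 2) Q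
      = (fCoeff f (Q + α) - (1 / 2 ^ n) * ∑ x, signChar (Q ⬝ᵥ x)) / 2 := by
    intro Q
    rw [← fCoeff_mul_signChar, fCoeff_eq, fCoeff_eq, ← mul_sub, ← Finset.sum_sub_distrib,
      mul_div_assoc, Finset.sum_div]
    congr 1
    exact Finset.sum_congr rfl fun x _ => by ring
  obtain ⟨t, z, ht, hz⟩ := exists_fCoeff_zero_mul_two_pow N (by simp [N])
    (fun x => (f x * signChar (α ⬝ᵥ x) - 1) / 2)
    (fun x => by
      rcases hf x with h | h <;> rcases signChar_eq_or (α ⬝ᵥ x) with h' | h' <;>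
        simp only [h, h']
      · exact ⟨0, by norm_num⟩
      · exact ⟨-1, by norm_num⟩
      · exact ⟨-1, by norm_num⟩
      · exact ⟨0, by norm_num⟩)
    (fun Q hQ hQN => by
      have : fCoeff f (Q + α) = 0 := by
        by_contra h; exact hQN (by simp [N, hQ, h])
      rw [hone, this, sum_signChar_dotProduct hQ]; simp)
  have hmean : fCoeff f α * 2 ^ t = 2 * z + 2 ^ t := by
    rw [← hz, hone]
    simp only [zero_add, zero_dotProduct, signChar_zero, Finset.sum_const, Finset.card_univ]
    simp only [Fintype.card_pi, ZMod.card, Finset.prod_const, Finset.card_univ, Fintype.card_fin]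
    field_simp
    simp
  have hne : fCoeff f α * 2 ^ t ≠ 0 := mul_ne_zero hα (by positivity)
  have h2m : (0 : ℝ) < 2 ^ m := by positivity
  have h2t : (0 : ℝ) < 2 ^ t := by positivity
  cases t with
  | zero =>
    have h1 : (1 : ℝ) ≤ |fCoeff f α| := by
      have e : fCoeff f α = ((2 * z + 1 : ℤ) : ℝ) := by push_cast; simpa using hmean
      rw [e, ← Int.cast_abs]
      exact_mod_cast Int.one_le_abs (by omega)
    have : (2 : ℝ) ^ m ≤ 1 := by nlinarith
    have h3 : (2 : ℕ) ^ m ≤ 1 := by exact_mod_cast this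
    rw [pow_succ]; omega
  | succ t =>
    have h1 : (2 : ℝ) ≤ |fCoeff f α| * 2 ^ (t + 1) := by
      have e : fCoeff f α * 2 ^ (t + 1) = 2 * ((z + 2 ^ t : ℤ) : ℝ) := by
        rw [hmean]; push_cast; ring
      have h4 : z + 2 ^ t ≠ 0 := fun h => hne (by rw [e, h]; simp)
      have h5 : (1 : ℝ) ≤ |((z + 2 ^ t : ℤ) : ℝ)| := by
        rw [← Int.cast_abs]; exact_mod_cast Int.one_le_abs h4
      have h6 : |fCoeff f α| * 2 ^ (t + 1) = 2 * |((z + 2 ^ t : ℤ) : ℝ)| := by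
        rw [← abs_of_pos h2t, ← abs_mul, e, abs_mul]; norm_num
      linarith
    have h7 : (2 : ℝ) ^ (m + 1) ≤ 2 ^ (t + 1) := by
      calc (2 : ℝ) ^ (m + 1) = 2 * 2 ^ m := by ring
        _ ≤ (|fCoeff f α| * 2 ^ (t + 1)) * 2 ^ m := by gcongr
        _ = (|fCoeff f α| * 2 ^ m) * 2 ^ (t + 1) := by ring
        _ ≤ 1 * 2 ^ (t + 1) := by gcongr
        _ = _ := one_mul _
    have h8 : 2 ^ (m + 1) ≤ 2 ^ (t + 1) := by exact_mod_cast h7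
    omega

/-- The Fourier coefficients of a restriction to a coordinate hyperplane. -/
theorem fCoeff_update {n : ℕ} (g : (Fin n → ZMod 2) → ℝ) (i : Fin n) (b : ZMod 2)
    {Q : Fin n → ZMod 2} (hQ : Q i = 0) :
    fCoeff (fun x => g (Function.update x i b)) Q
      = fCoeff g Q + signChar b * fCoeff g (Q + stdBasis i) := by
  have hpt : ∀ x : Fin n → ZMod 2, g (Function.update x i b) * signChar (Q ⬝ᵥ x)
      = (g x * signChar (Q ⬝ᵥ x)) * ((1 + signChar (b + x i)) / 2)
        + (g (x + stdBasis i) * signChar (Q ⬝ᵥ (x + stdBasis i)))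
          * ((1 + signChar (b + (x + stdBasis i) i)) / 2) := by
    intro x
    have hQe : Q ⬝ᵥ stdBasis i = 0 := by rw [dotProduct_comm, stdBasis_dotProduct, hQ]
    have hei : (stdBasis i : Fin n → ZMod 2) i = 1 := by simp [stdBasis]
    rw [dotProduct_add, hQe, add_zero, Pi.add_apply, hei]
    by_cases hx : x i = b
    · have h1 : b + x i = 0 := by rw [hx, CharTwo.add_self_eq_zero]
      rw [← add_assoc, h1, zero_add, signChar_zero, signChar_one, ← hx,
        Function.update_eq_self]
      ring
    · have hne : ∀ a b : ZMod 2, a ≠ b → a + 1 = b ∧ b + a = 1 := by decide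
      obtain ⟨h1, h3⟩ := hne _ _ hx
      have h2 : Function.update x i b = x + stdBasis i := by
        ext l
        by_cases hl : l = i
        · subst hl; simp [hei, h1]
        · simp [stdBasis, hl]
      rw [h1, CharTwo.add_self_eq_zero, h3, signChar_zero, signChar_one, h2]
      ring
  have e := Equiv.sum_comp (Equiv.addRight (stdBasis i)) fun x : Fin n → ZMod 2 =>
    (g x * signChar (Q ⬝ᵥ x)) * ((1 + signChar (b + x i)) / 2)
  simp only [Equiv.coe_addRight] at e
  rw [fCoeff_eq, fCoeff_eq, fCoeff_eq]
  simp only [hpt, Finset.sum_add_distrib, e]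
  rw [← mul_assoc, mul_comm (signChar b), mul_assoc, ← mul_add, Finset.mul_sum,
    ← Finset.sum_add_distrib, ← Finset.sum_add_distrib]
  congr 1
  refine Finset.sum_congr rfl fun x _ => ?_
  rw [signChar_add, add_dotProduct, signChar_add, stdBasis_dotProduct]
  ring

/-- The sign `(−1)^b` of the restriction `g^{(i)}`. -/
noncomputable def restrictSign {n : ℕ} (g : (Fin n → ZMod 2) → ℝ) (i : Fin n) : ℝ :=
  signChar (if fCoeff g (stdBasis i) < 0 then 1 else 0)

theorem restrictSign_mul_self {n : ℕ} (g : (Fin n → ZMod 2) → ℝ) (i : Fin n) :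
    restrictSign g i * restrictSign g i = 1 := signChar_mul_self _

/-- Frequencies outside the span of the support of the restriction cancel in pairs. -/
theorem fCoeff_add_stdBasis_of_notMem {n : ℕ} (g : (Fin n → ZMod 2) → ℝ) (i : Fin n)
    {Q : Fin n → ZMod 2} {C : Submodule (ZMod 2) (Fin n → ZMod 2)}
    (hC : fSupp (restrictAt g i) ⊆ C) (hi : stdBasis i ∈ C) (hQ : Q ∉ C) :
    fCoeff g (Q + stdBasis i) = -restrictSign g i * fCoeff g Q := by
  have hei : (stdBasis i : Fin n → ZMod 2) i = 1 := by simp [stdBasis]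
  have hs := restrictSign_mul_self g i
  have key : ∀ P : Fin n → ZMod 2, P i = 0 → P ∉ C →
      fCoeff g P + restrictSign g i * fCoeff g (P + stdBasis i) = 0 := by
    intro P hP hPC
    have h0 : fCoeff (restrictAt g i) P = 0 := by
      by_contra h; exact hPC (hC h)
    rw [← h0]
    exact (fCoeff_update g i _ hP).symm
  rcases eq_zero_or_one_zmod_two (Q i) with h | h
  · linear_combination restrictSign g i * key Q h hQ - fCoeff g (Q + stdBasis i) * hs
  · have h2 : Q + stdBasis i + stdBasis i = Q := by
      rw [add_assoc, show (stdBasis i + stdBasis i : Fin n → ZMod 2) = 0 from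
        funext fun l => CharTwo.add_self_eq_zero _, add_zero]
    have := key (Q + stdBasis i) (by rw [Pi.add_apply, h, hei]; decide)
      (fun hm => hQ (by rw [← h2]; exact C.add_mem hm hi))
    rw [h2] at this
    linear_combination this

/-- The distance from `i` to `j` travelling upwards around the cycle `Fin n`. -/
def cyclicDist {n : ℕ} (i j : Fin n) : ℕ :=
  if i.val ≤ j.val then j.val - i.val else j.val + n - i.val

theorem cyclicDist_self_lt {n : ℕ} {i j : Fin n} (h : i ≠ j) :
    cyclicDist i i < cyclicDist i j := by
  have := Fin.val_ne_of_ne h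
  unfold cyclicDist; split_ifs <;> omega

theorem cyclicDist_lt_of_le {n : ℕ} {a l j : Fin n} (hla : l ≠ a) (hlj : l ≠ j)
    (h : cyclicDist l j ≤ cyclicDist a j) : cyclicDist a l < cyclicDist a j := by
  have := Fin.val_ne_of_ne hla
  have := Fin.val_ne_of_ne hlj
  unfold cyclicDist at *; split_ifs at * <;> omega

/-- The span of the support of `g^{(i)}` and of the first `r` basis vectors met strictly before `j`
when travelling from `i` around the cycle. -/
noncomputable def arcSpan {n : ℕ} (g : (Fin n → ZMod 2) → ℝ) (r : ℕ) (i j : Fin n) :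
    Submodule (ZMod 2) (Fin n → ZMod 2) :=
  Submodule.span (ZMod 2) (fSupp (restrictAt g i) ∪
    stdBasis '' {l : Fin n | l.val < r ∧ cyclicDist i l < cyclicDist i j})

/-- `j` is a pivot of `i` if `e_j` is not in the span of what is met before `j`. -/
def IsPivot {n : ℕ} (g : (Fin n → ZMod 2) → ℝ) (r : ℕ) (i j : Fin n) : Prop :=
  i.val < r ∧ j.val < r ∧ i ≠ j ∧ stdBasis j ∉ arcSpan g r i j

theorem linearIndependent_stdBasis {n r : ℕ} (hrn : r ≤ n) :
    LinearIndependent (ZMod 2) fun j : Fin r =>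
      (stdBasis (Fin.castLE hrn j) : Fin n → ZMod 2) := by
  have h := (Pi.basisFun (ZMod 2) (Fin n)).linearIndependent.comp (Fin.castLE hrn)
    (Fin.castLE_injective hrn)
  convert h using 1
  ext j : 1
  simp [stdBasis_eq_single]

open Classical in
theorem le_finrank_add_card_isPivot {n r : ℕ} (hrn : r ≤ n) (g : (Fin n → ZMod 2) → ℝ)
    {i : Fin n} (hi : i.val < r) :
    r ≤ Module.finrank (ZMod 2) (Submodule.span (ZMod 2) (fSupp (restrictAt g i)))
      + (Finset.univ.filter fun j => IsPivot g r i j).card + 1 := by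
  set P := Finset.univ.filter fun j => IsPivot g r i j
  set M := Submodule.span (ZMod 2) (fSupp (restrictAt g i)) ⊔
    Submodule.span (ZMod 2) (((insert i P).image stdBasis : Finset (Fin n → ZMod 2)) :
      Set (Fin n → ZMod 2)) with hM
  have hmem : ∀ d, ∀ j : Fin n, cyclicDist i j = d → j.val < r → stdBasis j ∈ M := by
    intro d
    induction d using Nat.strong_induction_on with
    | _ d ih =>
    intro j hd hj
    by_cases hjP : j ∈ insert i P
    · exact Submodule.mem_sup_right
        (Submodule.subset_span (Finset.mem_coe.2 (Finset.mem_image_of_mem _ hjP)))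
    · rw [Finset.mem_insert, not_or] at hjP
      have hjC : stdBasis j ∈ arcSpan g r i j := by
        by_contra h
        exact hjP.2 (Finset.mem_filter.2 ⟨Finset.mem_univ _, hi, hj, Ne.symm hjP.1, h⟩)
      have hC : arcSpan g r i j ≤ M := by
        refine Submodule.span_le.2 (Set.union_subset ?_ ?_)
        · exact fun S hS => Submodule.mem_sup_left (Submodule.subset_span hS)
        · rintro _ ⟨l, ⟨hl, hlt⟩, rfl⟩
          exact ih _ (hd ▸ hlt) l rfl hl
      exact hC hjC
  have hle : Submodule.span (ZMod 2) (Set.range fun j : Fin r =>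
      (stdBasis (Fin.castLE hrn j) : Fin n → ZMod 2)) ≤ M := by
    refine Submodule.span_le.2 ?_
    rintro _ ⟨j, rfl⟩
    exact hmem _ _ rfl j.2
  have h1 := Submodule.finrank_mono hle
  rw [finrank_span_eq_card (linearIndependent_stdBasis hrn), Fintype.card_fin] at h1
  have h2 := Submodule.finrank_add_le_finrank_add_finrank
    (Submodule.span (ZMod 2) (fSupp (restrictAt g i)))
    (Submodule.span (ZMod 2) (((insert i P).image stdBasis : Finset (Fin n → ZMod 2)) :
      Set (Fin n → ZMod 2)))
  have h3 := finrank_span_finset_le_card (R := ZMod 2)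
    ((insert i P).image (stdBasis : Fin n → Fin n → ZMod 2))
  have h4 : ((insert i P).image (stdBasis : Fin n → Fin n → ZMod 2)).card ≤ P.card + 1 :=
    Finset.card_image_le.trans (Finset.card_insert_le _ _)
  simp only [Set.finrank] at h3
  rw [← hM] at h2
  omega

/-- Successive cancellations along pivots determine the coefficients on a cube based at `e_j`. -/
theorem fCoeff_stdBasis_add_sum {n r : ℕ} (g : (Fin n → ZMod 2) → ℝ) (j : Fin n)
    (J : Finset (Fin n)) (hJ : ∀ i ∈ J, IsPivot g r i j) :
    fCoeff g (stdBasis j + ∑ i ∈ J, stdBasis i)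
      = (∏ i ∈ J, -restrictSign g i) * fCoeff g (stdBasis j) := by
  induction J using Finset.induction_on_max_value (fun i => cyclicDist i j) with
  | empty => simp
  | insert a J ha hmax ih =>
    obtain ⟨har, hjr, haj, hpiv⟩ := hJ a (Finset.mem_insert_self _ _)
    have ih := ih fun i hi => hJ i (Finset.mem_insert_of_mem hi)
    have hJC : ∑ i ∈ J, stdBasis i ∈ arcSpan g r a j := by
      refine Submodule.sum_mem _ fun l hl => Submodule.subset_span (Or.inr ⟨l, ?_, rfl⟩)
      obtain ⟨hlr, -, hlj, -⟩ := hJ l (Finset.mem_insert_of_mem hl)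
      exact ⟨hlr, cyclicDist_lt_of_le (fun h => ha (h ▸ hl)) hlj (hmax l hl)⟩
    rw [Finset.sum_insert ha, Finset.prod_insert ha, add_comm (stdBasis a), ← add_assoc,
      fCoeff_add_stdBasis_of_notMem g a (C := arcSpan g r a j)
        (fun S hS => Submodule.subset_span (Or.inl hS))
        (Submodule.subset_span (Or.inr ⟨a, ⟨har, cyclicDist_self_lt haj⟩, rfl⟩))
        (fun h => hpiv ((Submodule.add_mem_iff_left _ hJC).1 h)), ih]
    ring

theorem sum_powerset_fCoeff {n : ℕ} (h : (Fin n → ZMod 2) → ℝ) (Q : Fin n → ZMod 2)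
    (c : Fin n → ℝ) (I : Finset (Fin n)) :
    ∑ J ∈ I.powerset, (∏ i ∈ J, c i) * fCoeff h (Q + ∑ i ∈ J, stdBasis i)
      = (1 / 2 ^ n) * ∑ x, h x * signChar (Q ⬝ᵥ x) * ∏ i ∈ I, (1 + c i * signChar (x i)) := by
  have hs : ∀ (J : Finset (Fin n)) (x : Fin n → ZMod 2),
      signChar ((∑ i ∈ J, stdBasis i) ⬝ᵥ x) = ∏ i ∈ J, signChar (x i) := by
    classical
    intro J x
    induction J using Finset.induction_on with
    | empty => simp [signChar_zero]
    | insert a J ha ih =>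
      rw [Finset.sum_insert ha, Finset.prod_insert ha, add_dotProduct, signChar_add, ih,
        stdBasis_dotProduct]
  simp only [fCoeff_eq, add_dotProduct, signChar_add, hs, Finset.prod_one_add,
    Finset.prod_mul_distrib, Finset.mul_sum]
  rw [Finset.sum_comm]
  exact Finset.sum_congr rfl fun x _ => Finset.sum_congr rfl fun J _ => by ring

open Classical in
theorem abs_fCoeff_stdBasis_mul_le {n r : ℕ} (g : (Fin n → ZMod 2) → ℝ)
    (hg : ∀ x, g x = 1 ∨ g x = -1) (j : Fin n) :
    |fCoeff g (stdBasis j)| * 2 ^ (Finset.univ.filter fun i => IsPivot g r i j).card ≤ 1 := by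
  set I := Finset.univ.filter fun i => IsPivot g r i j
  let c : Fin n → ℝ := fun i => -restrictSign g i
  have hcube := sum_powerset_fCoeff g (stdBasis j) c I
  have hconst : ∀ J ∈ I.powerset, (∏ i ∈ J, c i) * fCoeff g (stdBasis j + ∑ i ∈ J, stdBasis i)
      = fCoeff g (stdBasis j) := by
    intro J hJ
    rw [fCoeff_stdBasis_add_sum (r := r) g j J
      (fun i hi => (Finset.mem_filter.1 (Finset.mem_powerset.1 hJ hi)).2), ← mul_assoc,
      ← Finset.prod_mul_distrib]
    simp [c, restrictSign_mul_self]
  rw [Finset.sum_congr rfl hconst, Finset.sum_const, Finset.card_powerset, nsmul_eq_mul] at hcube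
  push_cast at hcube
  have hone := sum_powerset_fCoeff (fun _ => 1) (0 : Fin n → ZMod 2) c I
  rw [Finset.sum_eq_single ∅] at hone
  rotate_left
  · intro J _ hJ
    obtain ⟨a, ha⟩ := Finset.nonempty_iff_ne_empty.2 hJ
    have hne : (0 + ∑ i ∈ J, stdBasis i : Fin n → ZMod 2) ≠ 0 := by
      intro h
      have := congrFun h a
      simp [Finset.sum_apply, stdBasis, ha] at this
    simp only [fCoeff_eq, one_mul, sum_signChar_dotProduct hne, mul_zero]
  · simp
  have hmass : (1 / 2 ^ n : ℝ) * ∑ x : Fin n → ZMod 2, ∏ i ∈ I, (1 + c i * signChar (x i)) = 1 := by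
    have h1 : fCoeff (fun _ => 1) (0 : Fin n → ZMod 2) = 1 := by
      simp [fCoeff_eq, signChar_zero, ZMod.card]
    simpa [h1, signChar_zero] using hone.symm
  have hnn : ∀ x : Fin n → ZMod 2, 0 ≤ ∏ i ∈ I, (1 + c i * signChar (x i)) := by
    refine fun x => Finset.prod_nonneg fun i _ => ?_
    have : |c i * signChar (x i)| = 1 := by
      simp [c, abs_mul, abs_signChar, restrictSign]
    linarith [neg_abs_le (c i * signChar (x i))]
  calc |fCoeff g (stdBasis j)| * 2 ^ I.card = |2 ^ I.card * fCoeff g (stdBasis j)| := by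
        rw [abs_mul, abs_of_pos (by positivity : (0 : ℝ) < 2 ^ I.card), mul_comm]
    _ ≤ (1 / 2 ^ n) * ∑ x : Fin n → ZMod 2, ∏ i ∈ I, (1 + c i * signChar (x i)) := by
        rw [hcube, abs_mul, abs_of_pos (by positivity : (0 : ℝ) < 1 / 2 ^ n)]
        gcongr
        refine (Finset.abs_sum_le_sum_abs _ _).trans (Finset.sum_le_sum fun x _ => ?_)
        have hgx : |g x| = 1 := by rcases hg x with h | h <;> simp [h]
        rw [abs_mul, abs_mul, hgx, abs_signChar, abs_of_nonneg (hnn x), one_mul, one_mul]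
    _ = 1 := hmass

/-- If the first `r` standard basis vectors lie in the Fourier support, then some restriction
retains almost all of the dimension. -/
theorem exists_restrict_large_dim {n k r : ℕ} (hk : 2 ≤ k) (hr : 1 ≤ r) (hrn : r ≤ n)
    (g : (Fin n → ZMod 2) → ℝ) (hg : ∀ x, g x = 1 ∨ g x = -1)
    (hsparse : (fSupp g).ncard ≤ k)
    (hbasis : ∀ j : Fin n, j.val < r → fCoeff g (stdBasis j) ≠ 0) :
    ∃ i : Fin n, i.val < r ∧ (r : ℝ) - Real.logb 2 k ≤
      Module.finrank (ZMod 2) (Submodule.span (ZMod 2) (fSupp (restrictAt g i))) := by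
  classical
  let p : Fin n → ℕ := fun i => (Finset.univ.filter fun j => IsPivot g r i j).card
  let q : Fin n → ℕ := fun j => (Finset.univ.filter fun i => IsPivot g r i j).card
  have hpq : ∑ i, p i = ∑ j, q j := by
    simp only [p, q, Finset.card_filter]
    exact Finset.sum_comm
  have hpr : ∀ i : Fin n, ¬ i.val < r → p i = 0 := fun i hi => by
    simp [p, IsPivot, hi]
  have hqr : ∀ i : Fin n, ¬ i.val < r → q i = 0 := fun i hi => by
    simp [q, IsPivot, hi]
  obtain ⟨i, hi, hle⟩ : ∃ i : Fin n, i.val < r ∧ p i ≤ q i := by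
    by_contra! hc
    refine absurd hpq (ne_of_gt (Finset.sum_lt_sum (fun i _ => ?_)
      ⟨⟨0, by omega⟩, Finset.mem_univ _, hc _ hr⟩))
    by_cases h : i.val < r
    · exact (hc i h).le
    · rw [hqr i h, hpr i h]
  refine ⟨i, hi, ?_⟩
  have hk2 : 2 ^ (p i + 1) ≤ k :=
    (Nat.pow_le_pow_right (by norm_num) (Nat.succ_le_succ hle)).trans
      (fCoeff_granularity hk g hg hsparse (hbasis i hi) (abs_fCoeff_stdBasis_mul_le (r := r) g hg i))
  have hlog : ((p i + 1 : ℕ) : ℝ) ≤ Real.logb 2 k := by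
    rw [Real.le_logb_iff_rpow_le (by norm_num) (by positivity), Real.rpow_natCast]
    exact_mod_cast hk2
  have hdim := le_finrank_add_card_isPivot hrn g hi
  have hdim' : (r : ℝ) ≤ Module.finrank (ZMod 2)
      (Submodule.span (ZMod 2) (fSupp (restrictAt g i))) + ((p i + 1 : ℕ) : ℝ) := by
    exact_mod_cast hdim
  linarith

theorem fCoeff_changeBasis {n : ℕ} (f : (Fin n → ZMod 2) → ℝ)
    {B : Matrix (Fin n) (Fin n) (ZMod 2)} (hB : IsUnit B.det) (Q : Fin n → ZMod 2) :
    fCoeff (changeBasis f B) Q = fCoeff f (B.mulVec Q) := by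
  have hBt : IsUnit B.transpose.det := by rwa [Matrix.det_transpose]
  rw [fCoeff_eq, fCoeff_eq]
  congr 1
  refine Fintype.sum_equiv
    { toFun := B⁻¹.transpose.mulVec
      invFun := B.transpose.mulVec
      left_inv := fun x => by
        rw [Matrix.mulVec_mulVec, ← Matrix.transpose_mul, Matrix.nonsing_inv_mul _ hB,
          Matrix.transpose_one, Matrix.one_mulVec]
      right_inv := fun x => by
        rw [Matrix.mulVec_mulVec, ← Matrix.transpose_mul, Matrix.mul_nonsing_inv _ hB,
          Matrix.transpose_one, Matrix.one_mulVec] } _ _ fun x => ?_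
  simp only [changeBasis, Equiv.coe_fn_mk]
  congr 2
  rw [Matrix.mulVec_transpose, dotProduct_comm (B.mulVec Q), ← Matrix.dotProduct_mulVec,
    Matrix.mulVec_mulVec, Matrix.nonsing_inv_mul _ hB, Matrix.one_mulVec, dotProduct_comm]

/-- Every spanning set contains the first columns of an invertible matrix, as many as its rank. -/
theorem exists_isUnit_det_col_mem {n r : ℕ} (s : Set (Fin n → ZMod 2))
    (hs : Module.finrank (ZMod 2) (Submodule.span (ZMod 2) s) = r) :
    ∃ B : Matrix (Fin n) (Fin n) (ZMod 2), IsUnit B.det ∧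
      ∀ j : Fin n, j.val < r → B.mulVec (stdBasis j) ∈ s := by
  classical
  obtain ⟨b, hbs, hspan, hli⟩ := exists_linearIndependent (ZMod 2) s
  have hli' : LinearIndepOn (ZMod 2) id b := hli
  have hrn : r ≤ n := by
    rw [← hs]; simpa using Submodule.finrank_le (Submodule.span (ZMod 2) s)
  let v := Module.Basis.extend hli'
  have hcard : Fintype.card (Fin n)
      = Fintype.card (hli'.extend (Set.subset_univ b)) := by
    rw [← Module.finrank_eq_card_basis v]; simp
  let e₀ := Fintype.equivOfCardEq hcard
  have hbcard : Fintype.card b = r := by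
    rw [← hs, ← hspan]
    rw [← finrank_span_eq_card hli, Subtype.range_coe]
  have hpcard : Fintype.card {j : Fin n // j.val < r} = r := by
    rw [Fintype.card_subtype]
    simpa [hrn] using Fin.card_filter_val_lt (n := n) (m := r)
  have hqcard : Fintype.card {j : Fin n // (e₀ j : Fin n → ZMod 2) ∈ b} = r := by
    rw [← hbcard]
    refine Fintype.card_congr
      { toFun := fun j => ⟨e₀ j.1, j.2⟩
        invFun := fun x => ⟨e₀.symm ⟨x, hli'.subset_extend _ x.2⟩, by simp⟩
        left_inv := fun j => by simp
        right_inv := fun x => by simp }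
  let e := Fintype.equivOfCardEq (hpcard.trans hqcard.symm)
  let σ := e.extendSubtype
  have hσ : ∀ j : Fin n, j.val < r → (e₀ (σ j) : Fin n → ZMod 2) ∈ b := fun j hj =>
    e.extendSubtype_mem j hj
  let u := v.reindex (σ.trans e₀).symm
  have hu : ∀ j, u j = (e₀ (σ j) : Fin n → ZMod 2) := fun j => by
    simp [u, v]
  refine ⟨Matrix.of fun a j => u j a, ?_, fun j hj => ?_⟩
  · rw [← Matrix.isUnit_iff_isUnit_det, ← Matrix.linearIndependent_cols_iff_isUnit]
    exact u.linearIndependent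
  · rw [stdBasis_eq_single, Matrix.mulVec_single_one]
    have : (Matrix.of fun a j => u j a).col j = u j := rfl
    rw [this, hu]
    exact hbs (hσ j hj)

/-- **Structural lemma.** For every `k`-Fourier-sparse `f : 𝔽₂ⁿ → {−1,1}` with
`Fdim(f) = r`, there are an invertible `B ∈ 𝔽₂^{n×n}` and an index `i ∈ [r]` such that
`f̂_B(e_j) ≠ 0` for all `j ∈ [r]` and `Fdim((f_B)^{(i)}) ≥ r − log₂ k`. -/
theorem exists_changeBasis_restrict_large_dim {n k r : ℕ} (hk : 2 ≤ k) (hr : 1 ≤ r)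
    (f : (Fin n → ZMod 2) → ℝ) (hf : ∀ x, f x = 1 ∨ f x = -1)
    (hsparse : (fSupp f).ncard ≤ k)
    (hdim : Module.finrank (ZMod 2) (Submodule.span (ZMod 2) (fSupp f)) = r) :
    ∃ (B : Matrix (Fin n) (Fin n) (ZMod 2)) (i : Fin n), IsUnit B.det ∧ i.val < r ∧
      (∀ j : Fin n, j.val < r → fCoeff (changeBasis f B) (stdBasis j) ≠ 0) ∧
      (r : ℝ) - Real.logb 2 k ≤
        Module.finrank (ZMod 2)
          (Submodule.span (ZMod 2) (fSupp (restrictAt (changeBasis f B) i))) := by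
  obtain ⟨B, hB, hcol⟩ := exists_isUnit_det_col_mem (fSupp f) hdim
  have hrn : r ≤ n := by
    rw [← hdim]; simpa using Submodule.finrank_le (Submodule.span (ZMod 2) (fSupp f))
  have hbasis : ∀ j : Fin n, j.val < r → fCoeff (changeBasis f B) (stdBasis j) ≠ 0 :=
    fun j hj => by rw [fCoeff_changeBasis f hB]; exact hcol j hj
  have hcard : (fSupp (changeBasis f B)).ncard ≤ k := by
    refine le_trans (Set.ncard_le_ncard_of_injOn B.mulVec ?_ ?_ (Set.toFinite _)) hsparse
    · intro Q hQ
      simpa only [fSupp, Set.mem_ofPred_eq, fCoeff_changeBasis f hB] using hQ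
    · exact (Matrix.mulVec_injective_of_isUnit
        ((Matrix.isUnit_iff_isUnit_det B).2 hB)).injOn
  obtain ⟨i, hi, hdim'⟩ := exists_restrict_large_dim hk hr hrn (changeBasis f B)
    (fun x => hf _) hcard hbasis
  exact ⟨B, i, hB, hi, hbasis, hdim'⟩
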